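/- For all δ,ε>0 there exists Δ₀=Δ₀(δ,ε) such that for all Δ≥Δ₀, all 0<λ<(1−δ)·λ_c(Δ), every finite graph G of maximum degree Δ and girth at least 6, and every v∈V: |q̃*(v)/μ(v is occupied) − 1| ≤ ε, where μ is the hard-core Gibbs distribution, q̃*(v) = λ·ω*(v)/(1+λ·ω*(v)), and ω* is the unique fixed point of the belief-propagation operator F. -/

import Mathlib

open scoped BigOperators

attribute [local instance] Classical.propDecidable

noncomputable section

namespace HardCore

/-- The critical fugacity `λ_c(Δ) = (Δ-1)^(Δ-1) / (Δ-2)^Δ`. -/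
def lambdaC (D : ℕ) : ℝ := ((D : ℝ) - 1) ^ (D - 1) / ((D : ℝ) - 2) ^ D

variable {V : Type} [Fintype V] [DecidableEq V]

/-- `s` is an independent set of `G`. -/
def IsIndep (G : SimpleGraph V) (s : Finset V) : Prop :=
  ∀ u ∈ s, ∀ w ∈ s, ¬ G.Adj u w

/-- hard-core weight `λ^|σ|` of an independent set (0 for non-independent sets). -/
def weight (G : SimpleGraph V) (lam : ℝ) (s : Finset V) : ℝ :=
  if IsIndep G s then lam ^ s.card else 0

/-- The hard-core Gibbs distribution `μ(σ) = λ^|σ| / Z`. -/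
def gibbs (G : SimpleGraph V) (lam : ℝ) (s : Finset V) : ℝ :=
  weight G lam s / ∑ t : Finset V, weight G lam t

/-- Probability of an event under the Gibbs distribution. -/
def gibbsProb (G : SimpleGraph V) (lam : ℝ) (A : Set (Finset V)) : ℝ :=
  ∑ s : Finset V, if s ∈ A then gibbs G lam s else 0

/-- The belief-propagation operator `F(ω)(v) = ∏_{u ∈ N(v)} 1/(1 + λ·ω(u))`. -/
def bpF (G : SimpleGraph V) [DecidableRel G.Adj] (lam : ℝ) (ω : V → ℝ) : V → ℝ :=
  fun v => ∏ u ∈ G.neighborFinset v, (1 + lam * ω u)⁻¹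

end HardCore

open HardCore

namespace HardCore

variable {V : Type} [Fintype V] [DecidableEq V]

/-- Expectation of a function of the configuration under the Gibbs distribution. -/
def expect (G : SimpleGraph V) (lam : ℝ) (f : Finset V → ℝ) : ℝ :=
  ∑ s, gibbs G lam s * f s

/-- Indicator that no vertex of `s` other than `u` is adjacent to `w`. -/
def vac (G : SimpleGraph V) (u w : V) (s : Finset V) : ℝ :=
  if ∀ x ∈ s, x ≠ u → ¬ G.Adj w x then 1 else 0

/-- Indicator that `u` is unoccupied. -/
def unocc (u : V) (s : Finset V) : ℝ := if u ∈ s then 0 else 1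

/-- Conditional probability that all of `B ⊆ N(u)` is unoccupied, given that `u` is unoccupied and
given the configuration outside `B`. -/
def cavity (G : SimpleGraph V) (lam : ℝ) (u : V) (B : Finset V) (s : Finset V) : ℝ :=
  ∏ w ∈ B, (1 + lam * vac G u w s)⁻¹

section Indicators

variable (G : SimpleGraph V) (u w : V) (s : Finset V)

lemma vac_nonneg : 0 ≤ vac G u w s := by unfold vac; split_ifs <;> norm_num

lemma vac_le_one : vac G u w s ≤ 1 := by unfold vac; split_ifs <;> norm_num

omit [Fintype V] in
lemma unocc_nonneg : 0 ≤ unocc u s := by unfold unocc; split_ifs <;> norm_num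

omit [Fintype V] in
lemma unocc_le_one : unocc u s ≤ 1 := by unfold unocc; split_ifs <;> norm_num

lemma vac_insert {G : SimpleGraph V} {u w x : V} (s : Finset V) (h : G.Adj w x → x = u) :
    vac G u w (insert x s) = vac G u w s := by
  unfold vac
  congr 1
  simp only [Finset.mem_insert, forall_eq_or_imp, eq_iff_iff, and_iff_right_iff_imp]
  exact fun _ hx hw => hx (h hw)

omit [Fintype V] in
lemma unocc_insert {u x : V} (s : Finset V) (h : x ≠ u) : unocc u (insert x s) = unocc u s := by
  unfold unocc
  simp [Finset.mem_insert, h.symm]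

lemma cavity_insert {G : SimpleGraph V} {lam : ℝ} {u x : V} {B : Finset V} (s : Finset V)
    (h : ∀ w ∈ B, G.Adj w x → x = u) : cavity G lam u B (insert x s) = cavity G lam u B s :=
  Finset.prod_congr rfl fun w hw => by rw [vac_insert s (h w hw)]

variable {lam : ℝ} (hlam : 0 < lam) (B : Finset V)
include hlam

lemma one_le_one_add_mul_vac : 1 ≤ 1 + lam * vac G u w s :=
  le_add_of_nonneg_right (mul_nonneg hlam.le (vac_nonneg G u w s))

lemma cavity_pos : 0 < cavity G lam u B s :=
  Finset.prod_pos fun w _ =>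
    inv_pos.2 (one_pos.trans_le (one_le_one_add_mul_vac G u w s hlam))

lemma cavity_le_one : cavity G lam u B s ≤ 1 :=
  Finset.prod_le_one
    (fun w _ => inv_nonneg.2 (zero_le_one.trans (one_le_one_add_mul_vac G u w s hlam)))
    fun w _ => inv_le_one_of_one_le₀ (one_le_one_add_mul_vac G u w s hlam)

lemma abs_cavity_erase_sub_cavity_le {v : V} (hv : v ∈ B) :
    |cavity G lam u (B.erase v) s - cavity G lam u B s| ≤ lam := by
  have h1 := one_le_one_add_mul_vac G u v s hlam
  have h2 := cavity_pos G u s hlam (B.erase v)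
  have h3 := cavity_le_one G u s hlam (B.erase v)
  have h4 : cavity G lam u B s
      = (1 + lam * vac G u v s)⁻¹ * cavity G lam u (B.erase v) s :=
    (Finset.mul_prod_erase B _ hv).symm
  have h5 : 1 - lam ≤ (1 + lam * vac G u v s)⁻¹ := by
    rw [← one_div, le_div_iff₀ (by linarith)]
    have h6 := vac_nonneg G u v s
    have h7 := vac_le_one G u v s
    nlinarith [mul_nonneg hlam.le h6, mul_nonneg hlam.le (sub_nonneg.2 h7),
      mul_nonneg hlam.le (mul_nonneg hlam.le h6)]
  have h8 : (1 + lam * vac G u v s)⁻¹ ≤ 1 := inv_le_one_of_one_le₀ h1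
  rw [h4, abs_le]
  constructor <;> nlinarith

end Indicators

section Expectation

variable {G : SimpleGraph V} {lam : ℝ}

omit [DecidableEq V] in
lemma expect_add (f g : Finset V → ℝ) :
    expect G lam (fun s => f s + g s) = expect G lam f + expect G lam g := by
  simp only [expect, mul_add, Finset.sum_add_distrib]

omit [DecidableEq V] in
lemma expect_const_mul (c : ℝ) (f : Finset V → ℝ) :
    expect G lam (fun s => c * f s) = c * expect G lam f := by
  simp only [expect, Finset.mul_sum]
  exact Finset.sum_congr rfl fun s _ => by ring

omit [DecidableEq V] in
lemma expect_sub (f g : Finset V → ℝ) :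
    expect G lam (fun s => f s - g s) = expect G lam f - expect G lam g := by
  simp only [expect, mul_sub, Finset.sum_sub_distrib]

omit [DecidableEq V] in
lemma expect_sum {ι : Type*} (t : Finset ι) (f : ι → Finset V → ℝ) :
    expect G lam (fun s => ∑ i ∈ t, f i s) = ∑ i ∈ t, expect G lam (f i) := by
  simp only [expect, Finset.mul_sum]
  exact Finset.sum_comm

omit [Fintype V] [DecidableEq V] in
lemma weight_nonneg (hlam : 0 < lam) (s : Finset V) : 0 ≤ weight G lam s := by
  unfold weight; split_ifs <;> positivity

omit [DecidableEq V] in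
lemma sum_weight_pos (hlam : 0 < lam) : 0 < ∑ s, weight G lam s := by
  refine Finset.sum_pos' (fun s _ => weight_nonneg hlam s) ⟨∅, Finset.mem_univ _, ?_⟩
  simp [weight, IsIndep]

omit [DecidableEq V] in
lemma gibbs_nonneg (hlam : 0 < lam) (s : Finset V) : 0 ≤ gibbs G lam s :=
  div_nonneg (weight_nonneg hlam s) (sum_weight_pos hlam).le

omit [DecidableEq V] in
lemma expect_const (hlam : 0 < lam) (c : ℝ) : expect G lam (fun _ => c) = c := by
  unfold expect gibbs
  rw [← Finset.sum_mul, ← Finset.sum_div, div_self (sum_weight_pos hlam).ne', one_mul]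

omit [DecidableEq V] in
lemma expect_mono (hlam : 0 < lam) {f g : Finset V → ℝ} (h : ∀ s, f s ≤ g s) :
    expect G lam f ≤ expect G lam g :=
  Finset.sum_le_sum fun s _ => mul_le_mul_of_nonneg_left (h s) (gibbs_nonneg hlam s)

omit [DecidableEq V] in
lemma sq_expect_le (hlam : 0 < lam) (f : Finset V → ℝ) :
    expect G lam f ^ 2 ≤ expect G lam (fun s => f s ^ 2) := by
  have h : 0 ≤ expect G lam (fun s => (f s - expect G lam f) ^ 2) :=
    Finset.sum_nonneg fun s _ => mul_nonneg (gibbs_nonneg hlam s) (sq_nonneg _)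
  have h' : expect G lam (fun s => (f s - expect G lam f) ^ 2)
      = expect G lam (fun s => f s ^ 2) - expect G lam f ^ 2 := by
    have : ∀ s, (f s - expect G lam f) ^ 2
        = f s ^ 2 - 2 * expect G lam f * f s + expect G lam f ^ 2 := fun s => by ring
    simp only [this]
    rw [expect_add, expect_sub, expect_const_mul, expect_const hlam]
    ring
  linarith

lemma weight_insert {w : V} {s : Finset V} (hw : w ∉ s) :
    weight G lam (insert w s) = lam * vac G w w s * weight G lam s := by
  have key : IsIndep G (insert w s) ↔ (∀ x ∈ s, x ≠ w → ¬ G.Adj w x) ∧ IsIndep G s := by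
    constructor
    · intro h
      exact ⟨fun x hx _ => h w (Finset.mem_insert_self w s) x (Finset.mem_insert_of_mem hx),
        fun a ha b hb => h a (Finset.mem_insert_of_mem ha) b (Finset.mem_insert_of_mem hb)⟩
    · rintro ⟨h1, h2⟩ a ha b hb
      rcases Finset.mem_insert.1 ha with rfl | ha' <;> rcases Finset.mem_insert.1 hb with rfl | hb'
      · exact G.irrefl
      · exact h1 b hb' (ne_of_mem_of_not_mem hb' hw)
      · exact fun h => h1 a ha' (ne_of_mem_of_not_mem ha' hw) h.symm
      · exact h2 a ha' b hb'
  unfold weight vac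
  by_cases h1 : ∀ x ∈ s, x ≠ w → ¬ G.Adj w x <;> by_cases h2 : IsIndep G s
  · rw [if_pos (key.2 ⟨h1, h2⟩), if_pos h1, if_pos h2, Finset.card_insert_of_notMem hw]; ring
  · rw [if_neg fun h => h2 (key.1 h).2, if_neg h2]; ring
  · rw [if_neg fun h => h1 (key.1 h).1, if_neg h1]; ring
  · rw [if_neg fun h => h2 (key.1 h).2, if_neg h2]; ring

lemma sum_eq_sum_erase_powerset (w : V) (h : Finset V → ℝ) :
    ∑ s, h s = ∑ s ∈ (Finset.univ.erase w).powerset, (h s + h (insert w s)) := by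
  rw [Finset.sum_add_distrib, ← Finset.sum_powerset_insert (Finset.notMem_erase w _),
    Finset.insert_erase (Finset.mem_univ w), Finset.powerset_univ]

/-- Integrating out the spin of a single vertex. -/
lemma expect_eq_expect_unocc (w : V) {f : Finset V → ℝ} (hf : ∀ s, f (insert w s) = f s) :
    expect G lam f = expect G lam (fun s => unocc w s * (1 + lam * vac G w w s) * f s) := by
  unfold expect
  rw [sum_eq_sum_erase_powerset w, sum_eq_sum_erase_powerset w]
  refine Finset.sum_congr rfl fun s hs => ?_
  have hw : w ∉ s := fun h => Finset.notMem_erase w _ (Finset.mem_powerset.1 hs h)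
  simp only [gibbs, weight_insert hw, hf, unocc, hw, if_false, Finset.mem_insert_self, if_true]
  ring

/-- Integrating out the spins of an independent set of vertices. -/
lemma expect_eq_expect_prod_unocc (B : Finset V) :
    (∀ a ∈ B, ∀ b ∈ B, ¬ G.Adj a b) → ∀ f : Finset V → ℝ,
      (∀ w ∈ B, ∀ s, f (insert w s) = f s) →
      expect G lam f =
        expect G lam (fun s => (∏ w ∈ B, (unocc w s * (1 + lam * vac G w w s))) * f s) := by
  induction B using Finset.induction_on with
  | empty => intro _ f _; simp
  | insert w B hw ih =>
    intro hB f hf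
    rw [ih (fun a ha b hb => hB a (Finset.mem_insert_of_mem ha) b (Finset.mem_insert_of_mem hb)) f
      (fun a ha => hf a (Finset.mem_insert_of_mem ha)), expect_eq_expect_unocc w]
    · simp only [Finset.prod_insert hw, mul_assoc]
    · intro s
      rw [hf w (Finset.mem_insert_self w B)]
      congr 1
      refine Finset.prod_congr rfl fun a ha => ?_
      rw [unocc_insert s (ne_of_mem_of_not_mem ha hw).symm, vac_insert s fun h =>
        absurd h (hB a (Finset.mem_insert_of_mem ha) w (Finset.mem_insert_self w B))]

/-- The defining property of `cavity`: it is the conditional probability that `B` is empty. -/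
lemma expect_unocc_mul_cavity (hlam : 0 < lam) {u : V} {B : Finset V} (hu : u ∉ B)
    (hB : ∀ a ∈ B, ∀ b ∈ B, ¬ G.Adj a b) {H : Finset V → ℝ}
    (hH : ∀ w ∈ B, ∀ s, H (insert w s) = H s) :
    expect G lam (fun s => unocc u s * cavity G lam u B s * H s) =
      expect G lam (fun s => unocc u s * (∏ w ∈ B, unocc w s) * H s) := by
  rw [expect_eq_expect_prod_unocc B hB]
  · congr 1
    funext s
    by_cases hus : u ∈ s
    · simp [unocc, hus]
    · have h1 : ∀ w, vac G w w s = vac G u w s := fun w => by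
        unfold vac
        congr 1
        refine propext ⟨fun h x hx _ hadj => h x hx hadj.ne' hadj,
          fun h x hx _ => h x hx (ne_of_mem_of_not_mem hx hus)⟩
      have h2 : (∏ w ∈ B, (1 + lam * vac G w w s)) * cavity G lam u B s = 1 := by
        unfold cavity
        rw [← Finset.prod_mul_distrib]
        refine Finset.prod_eq_one fun w _ => ?_
        rw [h1]
        exact mul_inv_cancel₀ (one_pos.trans_le (one_le_one_add_mul_vac G u w s hlam)).ne'
      rw [Finset.prod_mul_distrib]
      linear_combination ((∏ w ∈ B, unocc w s) * unocc u s * H s) * h2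
  · intro w hw s
    rw [hH w hw, unocc_insert s (ne_of_mem_of_not_mem hw hu),
      cavity_insert s fun a ha h => absurd h (hB a ha w hw)]

end Expectation

end HardCore

namespace HardCore

section Analysis

open Real

lemma abs_exp_sub_exp_le {a b : ℝ} (ha : a ≤ 0) (hb : b ≤ 0) : |exp a - exp b| ≤ |a - b| := by
  have key : ∀ {x y : ℝ}, x ≤ 0 → exp x - exp y ≤ |x - y| := by
    intro x y hx
    have h1 : exp y = exp x * exp (y - x) := by rw [← exp_add]; ring_nf
    have h2 := add_one_le_exp (y - x)
    have h3 : exp x ≤ 1 := exp_le_one_iff.2 hx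
    have h4 := exp_pos x
    rw [h1]
    nlinarith [le_abs_self (x - y), abs_nonneg (x - y)]
  refine abs_le.2 ⟨?_, key ha⟩
  have := key (y := a) hb
  rw [abs_sub_comm] at this
  linarith

lemma mul_exp_neg_le (t : ℝ) : t * exp (-t) ≤ exp (-1) := by
  have h := add_one_le_exp (t - 1)
  have h2 : exp (-1) = exp (t - 1) * exp (-t) := by rw [← exp_add]; ring_nf
  rw [h2]
  exact mul_le_mul_of_nonneg_right (by linarith) (exp_pos _).le

/-- The radial profile of the belief-propagation operator in square-root coordinates is
`√(λ/e)`-Lipschitz. -/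
lemma sq_exp_sub_exp_le {lam : ℝ} (hlam : 0 < lam) (r t : ℝ) :
    (exp (-(lam / 2) * r ^ 2) - exp (-(lam / 2) * t ^ 2)) ^ 2
      ≤ lam * exp (-1) * (r - t) ^ 2 := by
  have hderiv : ∀ x : ℝ, HasDerivAt (fun y : ℝ => exp (-(lam / 2) * y ^ 2))
      (exp (-(lam / 2) * x ^ 2) * (-(lam / 2) * (2 * x))) x := by
    intro x
    have := ((hasDerivAt_pow 2 x).const_mul (-(lam / 2))).exp
    simpa using this
  have hbound : ∀ x : ℝ, ‖exp (-(lam / 2) * x ^ 2) * (-(lam / 2) * (2 * x))‖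
      ≤ √(lam * exp (-1)) := by
    intro x
    refine le_sqrt_of_sq_le ?_
    have h1 := mul_exp_neg_le (lam * x ^ 2)
    have h2 : exp (-(lam * x ^ 2)) = exp (-(lam / 2) * x ^ 2) ^ 2 := by
      rw [← exp_nat_mul]; congr 1; push_cast; ring
    rw [h2] at h1
    rw [norm_eq_abs, sq_abs]
    calc (exp (-(lam / 2) * x ^ 2) * (-(lam / 2) * (2 * x))) ^ 2
        = lam * (lam * x ^ 2 * exp (-(lam / 2) * x ^ 2) ^ 2) := by ring
      _ ≤ lam * exp (-1) := mul_le_mul_of_nonneg_left h1 hlam.le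
  have hlip := convex_univ.norm_image_sub_le_of_norm_hasDerivWithin_le
    (fun x _ => (hderiv x).hasDerivWithinAt) (fun x _ => hbound x)
    (Set.mem_univ t) (Set.mem_univ r)
  rw [norm_eq_abs, norm_eq_abs] at hlip
  have hsq := pow_le_pow_left₀ (abs_nonneg _) hlip 2
  rwa [mul_pow, sq_abs, sq_abs, sq_sqrt (by positivity)] at hsq

lemma sq_sqrt_sum_sub_sqrt_sum_le {ι : Type*} (N : Finset ι) {x y : ι → ℝ}
    (hx : ∀ u, 0 ≤ x u) (hy : ∀ u, 0 ≤ y u) :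
    (√(∑ u ∈ N, x u) - √(∑ u ∈ N, y u)) ^ 2 ≤ ∑ u ∈ N, (√(x u) - √(y u)) ^ 2 := by
  have h := sum_sqrt_mul_sqrt_le N hx hy
  have h1 : ∑ u ∈ N, (√(x u) - √(y u)) ^ 2
      = ∑ u ∈ N, x u + ∑ u ∈ N, y u - 2 * ∑ u ∈ N, √(x u) * √(y u) := by
    rw [Finset.mul_sum, ← Finset.sum_add_distrib, ← Finset.sum_sub_distrib]
    refine Finset.sum_congr rfl fun u _ => ?_
    rw [sub_sq, sq_sqrt (hx u), sq_sqrt (hy u)]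
    ring
  rw [h1, sub_sq, sq_sqrt (Finset.sum_nonneg fun u _ => hx u),
    sq_sqrt (Finset.sum_nonneg fun u _ => hy u)]
  linarith

lemma sq_exp_sum_sub_exp_sum_le {ι : Type*} (N : Finset ι) {lam : ℝ} (hlam : 0 < lam)
    {x y : ι → ℝ} (hx : ∀ u, 0 ≤ x u) (hy : ∀ u, 0 ≤ y u) :
    (exp (-(lam / 2) * ∑ u ∈ N, x u) - exp (-(lam / 2) * ∑ u ∈ N, y u)) ^ 2
      ≤ lam * exp (-1) * ∑ u ∈ N, (√(x u) - √(y u)) ^ 2 := by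
  have h := sq_exp_sub_exp_le hlam (√(∑ u ∈ N, x u)) (√(∑ u ∈ N, y u))
  rw [sq_sqrt (Finset.sum_nonneg fun u _ => hx u),
    sq_sqrt (Finset.sum_nonneg fun u _ => hy u)] at h
  exact h.trans
    (mul_le_mul_of_nonneg_left (sq_sqrt_sum_sub_sqrt_sum_le N hx hy) (by positivity))

lemma abs_log_one_add_sub_le {t : ℝ} (ht : 0 ≤ t) : |log (1 + t) - t| ≤ t ^ 2 / 2 := by
  have h1 := le_log_one_add_of_nonneg ht
  have h2 := log_le_sub_one_of_pos (show 0 < 1 + t by linarith)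
  have h3 : t - t ^ 2 / 2 ≤ 2 * t / (t + 2) := by
    rw [le_div_iff₀ (by linarith)]
    nlinarith [pow_nonneg ht 3]
  rw [abs_le]
  constructor <;> nlinarith [sq_nonneg t]

/-- Replacing the belief-propagation product by an exponential. -/
lemma abs_sqrt_prod_sub_exp_le {ι : Type*} (N : Finset ι) {lam c : ℝ} (hlam : 0 < lam)
    (hc : 0 ≤ c) {x : ι → ℝ} (hx : ∀ u, x u ∈ Set.Icc (0 : ℝ) 1) :
    |√(∏ u ∈ N, (1 + lam * x u)⁻¹) - exp (-(lam / 2) * c)|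
      ≤ N.card * lam ^ 2 / 4 + lam / 2 * |∑ u ∈ N, x u - c| := by
  have hpos : ∀ u, 0 < 1 + lam * x u := fun u => by nlinarith [(hx u).1]
  have hlog : ∀ u, 0 ≤ log (1 + lam * x u) := fun u => log_nonneg (by nlinarith [(hx u).1])
  have h1 : √(∏ u ∈ N, (1 + lam * x u)⁻¹) = exp (-(∑ u ∈ N, log (1 + lam * x u)) / 2) := by
    rw [exp_half, ← Finset.sum_neg_distrib, exp_sum]
    congr 1
    refine Finset.prod_congr rfl fun u _ => ?_
    rw [exp_neg, exp_log (hpos u)]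
  have h2 : |∑ u ∈ N, log (1 + lam * x u) - lam * ∑ u ∈ N, x u| ≤ N.card * (lam ^ 2 / 2) := by
    rw [Finset.mul_sum, ← Finset.sum_sub_distrib, ← nsmul_eq_mul]
    refine (Finset.abs_sum_le_sum_abs _ _).trans (Finset.sum_le_card_nsmul _ _ _ fun u _ => ?_)
    refine (abs_log_one_add_sub_le (mul_nonneg hlam.le (hx u).1)).trans ?_
    rw [mul_pow]
    nlinarith [mul_le_mul_of_nonneg_left (pow_le_one₀ (n := 2) (hx u).1 (hx u).2) (sq_nonneg lam)]
  have h3 : 0 ≤ ∑ u ∈ N, log (1 + lam * x u) := Finset.sum_nonneg fun u _ => hlog u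
  rw [h1]
  refine (abs_exp_sub_exp_le (by linarith) (by nlinarith [mul_nonneg hlam.le hc])).trans ?_
  have h4 : -(∑ u ∈ N, log (1 + lam * x u)) / 2 - -(lam / 2) * c
      = -(1 / 2) * (∑ u ∈ N, log (1 + lam * x u) - lam * ∑ u ∈ N, x u)
        + -(lam / 2) * (∑ u ∈ N, x u - c) := by ring
  rw [h4]
  refine (abs_add_le _ _).trans ?_
  rw [abs_mul, abs_mul, abs_neg, abs_neg, abs_of_pos (half_pos hlam),
    abs_of_pos (by norm_num : (0 : ℝ) < 1 / 2)]
  linarith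

/-- An approximate solution of the belief-propagation equation at a vertex is compared with an
exact one. -/
lemma sq_sqrt_prod_sub_sqrt_prod_le {ι : Type*} (N : Finset ι) {lam η : ℝ} (hlam : 0 < lam)
    (hη : 0 < η) {z x y : ι → ℝ} (hz : ∀ u, z u ∈ Set.Icc (0 : ℝ) 1) (hx : ∀ u, 0 ≤ x u)
    (hy : ∀ u, y u ∈ Set.Icc (0 : ℝ) 1) :
    (√(∏ u ∈ N, (1 + lam * z u)⁻¹) - √(∏ u ∈ N, (1 + lam * y u)⁻¹)) ^ 2
      ≤ (1 + η) * (lam * exp (-1)) * ∑ u ∈ N, (√(x u) - √(y u)) ^ 2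
        + (1 + 1 / η) * (N.card ^ 2 * lam ^ 4 / 2 + lam ^ 2 / 2 * (∑ u ∈ N, (z u - x u)) ^ 2) := by
  have h1 := abs_sqrt_prod_sub_exp_le N hlam (Finset.sum_nonneg fun u (_ : u ∈ N) => hx u) hz
  have h2 := abs_sqrt_prod_sub_exp_le N hlam (Finset.sum_nonneg fun u (_ : u ∈ N) => (hy u).1) hy
  have h3 := sq_exp_sum_sub_exp_sum_le N hlam hx fun u => (hy u).1
  rw [sub_self, abs_zero, mul_zero, add_zero] at h2
  rw [← Finset.sum_sub_distrib] at h1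
  set A := √(∏ u ∈ N, (1 + lam * z u)⁻¹)
  set A' := √(∏ u ∈ N, (1 + lam * y u)⁻¹)
  set b := exp (-(lam / 2) * ∑ u ∈ N, x u)
  set b' := exp (-(lam / 2) * ∑ u ∈ N, y u)
  set S := ∑ u ∈ N, (z u - x u)
  have h4 : |(A - b) - (A' - b')| ≤ N.card * lam ^ 2 / 2 + lam / 2 * |S| :=
    (abs_sub _ _).trans (by linarith)
  have h5 : ((A - b) - (A' - b')) ^ 2 ≤ N.card ^ 2 * lam ^ 4 / 2 + lam ^ 2 / 2 * S ^ 2 := by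
    have h6 := pow_le_pow_left₀ (abs_nonneg _) h4 2
    rw [sq_abs] at h6
    have h7 := sq_nonneg (N.card * lam ^ 2 / 2 - lam / 2 * |S|)
    have h8 := sq_abs S
    nlinarith
  have h6 : (A - A') ^ 2 ≤ (1 + η) * (b - b') ^ 2 + (1 + 1 / η) * ((A - b) - (A' - b')) ^ 2 := by
    have h7 : (1 + η) * (b - b') ^ 2 + (1 + 1 / η) * ((A - b) - (A' - b')) ^ 2 - (A - A') ^ 2
        = 1 / η * (η * (b - b') - ((A - b) - (A' - b'))) ^ 2 := by
      field_simp
      ring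
    have h8 : 0 ≤ 1 / η * (η * (b - b') - ((A - b) - (A' - b'))) ^ 2 := by positivity
    linarith
  refine h6.trans (add_le_add ?_ (mul_le_mul_of_nonneg_left h5 (by positivity)))
  rw [mul_assoc]
  exact mul_le_mul_of_nonneg_left h3 (by positivity)

end Analysis

end HardCore

namespace HardCore

variable {V : Type} {G : SimpleGraph V}

section Girth

lemma triangleFree_of_le_egirth (hG : 6 ≤ G.egirth) {a b c : V} (hab : G.Adj a b)
    (hbc : G.Adj b c) : ¬ G.Adj c a := by
  intro hca
  have h := SimpleGraph.le_egirth.1 hG a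
    (.cons hab (.cons hbc (.cons hca .nil))) (by
      rw [SimpleGraph.Walk.cons_isCycle_iff]
      simp [SimpleGraph.Walk.isPath_def, hab.ne, hbc.ne, hca.ne, hab.ne', hca.ne'])
  exact absurd h (by norm_num [← Nat.cast_ofNat (R := ℕ∞), -Nat.cast_ofNat])

lemma eq_or_eq_of_le_egirth (hG : 6 ≤ G.egirth) {a b c d : V} (hab : G.Adj a b)
    (hbc : G.Adj b c) (hcd : G.Adj c d) (hda : G.Adj d a) : a = c ∨ b = d := by
  by_contra! hne
  have h := SimpleGraph.le_egirth.1 hG a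
    (.cons hab (.cons hbc (.cons hcd (.cons hda .nil)))) (by
      rw [SimpleGraph.Walk.cons_isCycle_iff]
      simp [SimpleGraph.Walk.isPath_def, hab.ne, hbc.ne, hcd.ne, hda.ne, hab.ne', hda.ne',
        hne.1, hne.2, hne.1.symm])
  exact absurd h (by norm_num [← Nat.cast_ofNat (R := ℕ∞), -Nat.cast_ofNat])

lemma pentagonFree_of_le_egirth (hG : 6 ≤ G.egirth) {a b c d e : V} (hab : G.Adj a b)
    (hbc : G.Adj b c) (hcd : G.Adj c d) (hde : G.Adj d e) : ¬ G.Adj e a := by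
  intro hea
  have hac : a ≠ c := fun h => triangleFree_of_le_egirth hG hcd hde (h ▸ hea)
  have had : a ≠ d := fun h => triangleFree_of_le_egirth hG hab hbc (h ▸ hcd)
  have hbd : b ≠ d := fun h => triangleFree_of_le_egirth hG hde hea (h ▸ hab)
  have hbe : b ≠ e := fun h => triangleFree_of_le_egirth hG hbc hcd (h ▸ hde)
  have hce : c ≠ e := fun h => triangleFree_of_le_egirth hG hea hab (h ▸ hbc)
  have h := SimpleGraph.le_egirth.1 hG a
    (.cons hab (.cons hbc (.cons hcd (.cons hde (.cons hea .nil))))) (by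
      rw [SimpleGraph.Walk.cons_isCycle_iff]
      simp [SimpleGraph.Walk.isPath_def, hab.ne, hbc.ne, hcd.ne, hde.ne, hea.ne, hab.ne',
        hea.ne', hac, had, hbd, hbe, hce, hac.symm, had.symm])
  exact absurd h (by norm_num [← Nat.cast_ofNat (R := ℕ∞), -Nat.cast_ofNat])

end Girth

variable [Fintype V] [DecidableEq V] [DecidableRel G.Adj] {lam : ℝ}

lemma prod_unocc_erase (u v : V) (s : Finset V) :
    ∏ w ∈ (G.neighborFinset u).erase v, unocc w s = vac G v u s := by
  unfold vac
  split_ifs with h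
  · refine Finset.prod_eq_one fun w hw => if_neg fun hws => ?_
    rw [Finset.mem_erase, SimpleGraph.mem_neighborFinset] at hw
    exact h w hws hw.1 hw.2
  · push Not at h
    obtain ⟨x, hx, hxv, hadj⟩ := h
    exact Finset.prod_eq_zero (i := x) (by simp [hxv, hadj]) (if_pos hx)

/-- The fluctuation of the indicator that `u` is not blocked by a vertex other than `v`, around its
conditional probability. -/
def fluct (G : SimpleGraph V) [DecidableRel G.Adj] (lam : ℝ) (v u : V) (s : Finset V) : ℝ :=
  unocc u s * (vac G v u s - cavity G lam u ((G.neighborFinset u).erase v) s)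

omit [DecidableRel G.Adj] in
lemma abs_vac_sub_cavity_le (hlam : 0 < lam) (v u : V) (B s : Finset V) :
    |vac G v u s - cavity G lam u B s| ≤ 1 := by
  have h1 := vac_nonneg G v u s
  have h2 := vac_le_one G v u s
  have h3 := cavity_pos G u s hlam B
  have h4 := cavity_le_one G u s hlam B
  rw [abs_le]
  constructor <;> linarith

lemma sq_fluct_le_one (hlam : 0 < lam) (v u : V) (s : Finset V) :
    fluct G lam v u s ^ 2 ≤ 1 := by
  rw [sq_le_one_iff_abs_le_one, fluct, abs_mul, abs_of_nonneg (unocc_nonneg u s)]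
  exact mul_le_one₀ (unocc_le_one u s) (abs_nonneg _) (abs_vac_sub_cavity_le hlam v u _ s)

lemma fluct_insert (hG : 6 ≤ G.egirth) {v u u' w : V} (hu : G.Adj v u) (hu' : G.Adj v u')
    (hne : u ≠ u') (huw : G.Adj u w) (s : Finset V) :
    fluct G lam v u' (insert w s) = fluct G lam v u' s := by
  unfold fluct
  rw [unocc_insert, vac_insert, cavity_insert]
  · intro a ha haw
    rw [Finset.mem_erase, SimpleGraph.mem_neighborFinset] at ha
    exact absurd hu.symm (pentagonFree_of_le_egirth hG hu' ha.2 haw huw.symm)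
  · intro h
    rcases eq_or_eq_of_le_egirth hG hu huw h.symm hu'.symm with h' | h'
    · exact h'.symm
    · exact absurd h' hne
  · rintro rfl
    exact triangleFree_of_le_egirth hG hu huw hu'.symm

omit [DecidableEq V] in
lemma neighborFinset_indep (hG : 6 ≤ G.egirth) (u : V) :
    ∀ a ∈ G.neighborFinset u, ∀ b ∈ G.neighborFinset u, ¬ G.Adj a b := by
  intro a ha b hb hab
  rw [SimpleGraph.mem_neighborFinset] at ha hb
  exact triangleFree_of_le_egirth hG ha hab hb.symm

lemma expect_fluct_mul_fluct (hG : 6 ≤ G.egirth) (hlam : 0 < lam) {v u u' : V} (hu : G.Adj v u)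
    (hu' : G.Adj v u') (hne : u ≠ u') :
    expect G lam (fun s => fluct G lam v u s * fluct G lam v u' s) = 0 := by
  have h := expect_unocc_mul_cavity (G := G) hlam (u := u)
    (B := (G.neighborFinset u).erase v) (H := fluct G lam v u') (by simp)
    (fun a ha b hb => neighborFinset_indep hG u a (Finset.mem_of_mem_erase ha) b
      (Finset.mem_of_mem_erase hb))
    (fun w hw s => by
      rw [Finset.mem_erase, SimpleGraph.mem_neighborFinset] at hw
      exact fluct_insert hG hu hu' hne hw.2 s)
  simp only [prod_unocc_erase] at h
  have h' := expect_sub (G := G) (lam := lam)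
    (fun s => unocc u s * vac G v u s * fluct G lam v u' s)
    (fun s => unocc u s * cavity G lam u ((G.neighborFinset u).erase v) s * fluct G lam v u' s)
  rw [h, sub_self] at h'
  rw [← h']
  congr 1
  funext s
  rw [fluct]
  ring

lemma expect_sq_sum_fluct_le (hG : 6 ≤ G.egirth) (hlam : 0 < lam) (v : V) :
    expect G lam (fun s => (∑ u ∈ G.neighborFinset v, fluct G lam v u s) ^ 2)
      ≤ (G.neighborFinset v).card := by
  simp only [sq, Finset.sum_mul_sum]
  rw [expect_sum, ← nsmul_one, ← Finset.sum_const]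
  refine Finset.sum_le_sum fun u hu => ?_
  rw [expect_sum, Finset.sum_eq_single_of_mem u hu]
  · rw [← expect_const (G := G) hlam 1]
    exact expect_mono hlam fun s => by simpa only [sq] using sq_fluct_le_one hlam v u s
  · intro u' hu' hne
    rw [SimpleGraph.mem_neighborFinset] at hu hu'
    exact expect_fluct_mul_fluct hG hlam hu hu' hne.symm

omit [DecidableRel G.Adj] in
lemma expect_occupied_le (hlam : 0 < lam) (u : V) :
    expect G lam (fun s => 1 - unocc u s) ≤ lam := by
  have h := expect_eq_expect_unocc (G := G) (lam := lam) u (f := fun _ => 1) fun _ => rfl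
  have h2 : expect G lam (fun s => unocc u s * (1 + lam * vac G u u s) * 1)
      ≤ expect G lam (fun s => unocc u s + lam) := expect_mono hlam fun s => by
    have h3 := unocc_nonneg u s
    have h4 := mul_le_one₀ (unocc_le_one u s) (vac_nonneg G u u s) (vac_le_one G u u s)
    nlinarith
  rw [expect_sub, expect_const hlam]
  rw [← h, expect_add, expect_const hlam, expect_const hlam] at h2
  linarith

/-- Second moment bound for the number of unblocked neighbours of `v`, around the sum of the
conditional probabilities. -/
lemma expect_sq_sum_vac_sub_cavity_le (hG : 6 ≤ G.egirth) (hlam : 0 < lam) {D : ℝ}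
    (hdeg : ∀ u, ((G.neighborFinset u).card : ℝ) ≤ D) (hD : lam * D ≤ 3) (v : V) :
    expect G lam (fun s => (∑ u ∈ G.neighborFinset v,
        (vac G v u s - cavity G lam u (G.neighborFinset u) s)) ^ 2) ≤ 12 * D + 27 := by
  have hcard0 : (0 : ℝ) ≤ (G.neighborFinset v).card := Nat.cast_nonneg _
  have hcard := hdeg v
  have hpt : ∀ s, (∑ u ∈ G.neighborFinset v,
        (vac G v u s - cavity G lam u (G.neighborFinset u) s)) ^ 2
      ≤ 3 * (∑ u ∈ G.neighborFinset v, fluct G lam v u s) ^ 2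
        + 3 * D * (∑ u ∈ G.neighborFinset v, (1 - unocc u s)) + 27 := by
    intro s
    have hsplit : ∑ u ∈ G.neighborFinset v,
          (vac G v u s - cavity G lam u (G.neighborFinset u) s)
        = ∑ u ∈ G.neighborFinset v, fluct G lam v u s
          + ∑ u ∈ G.neighborFinset v, (1 - unocc u s) *
              (vac G v u s - cavity G lam u ((G.neighborFinset u).erase v) s)
          + ∑ u ∈ G.neighborFinset v, (cavity G lam u ((G.neighborFinset u).erase v) s
              - cavity G lam u (G.neighborFinset u) s) := by
      rw [← Finset.sum_add_distrib, ← Finset.sum_add_distrib]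
      refine Finset.sum_congr rfl fun u _ => ?_
      rw [fluct]
      ring
    have h2 : |∑ u ∈ G.neighborFinset v, (1 - unocc u s) *
        (vac G v u s - cavity G lam u ((G.neighborFinset u).erase v) s)|
        ≤ ∑ u ∈ G.neighborFinset v, (1 - unocc u s) := by
      refine (Finset.abs_sum_le_sum_abs _ _).trans (Finset.sum_le_sum fun u _ => ?_)
      have h := sub_nonneg.2 (unocc_le_one u s)
      rw [abs_mul, abs_of_nonneg h]
      exact mul_le_of_le_one_right h (abs_vac_sub_cavity_le hlam v u _ s)
    have h2' : ∑ u ∈ G.neighborFinset v, (1 - unocc u s) ≤ D := by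
      refine (Finset.sum_le_card_nsmul _ _ 1 fun u _ => ?_).trans ?_
      · linarith [unocc_nonneg u s]
      · simpa using hcard
    have h2'' : 0 ≤ ∑ u ∈ G.neighborFinset v, (1 - unocc u s) :=
      Finset.sum_nonneg fun u _ => sub_nonneg.2 (unocc_le_one u s)
    have h3 : |∑ u ∈ G.neighborFinset v, (cavity G lam u ((G.neighborFinset u).erase v) s
        - cavity G lam u (G.neighborFinset u) s)| ≤ 3 := by
      refine (Finset.abs_sum_le_sum_abs _ _).trans
        ((Finset.sum_le_card_nsmul _ _ lam fun u hu => ?_).trans ?_)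
      · rw [SimpleGraph.mem_neighborFinset] at hu
        exact abs_cavity_erase_sub_cavity_le G u s hlam _ (by simpa using hu.symm)
      · rw [nsmul_eq_mul]
        nlinarith
    rw [hsplit]
    set a := ∑ u ∈ G.neighborFinset v, fluct G lam v u s
    set b := ∑ u ∈ G.neighborFinset v, (1 - unocc u s) *
        (vac G v u s - cavity G lam u ((G.neighborFinset u).erase v) s)
    set c := ∑ u ∈ G.neighborFinset v, (cavity G lam u ((G.neighborFinset u).erase v) s
        - cavity G lam u (G.neighborFinset u) s)
    set n := ∑ u ∈ G.neighborFinset v, (1 - unocc u s)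
    have hb : b ^ 2 ≤ D * n := by
      rw [← sq_abs]
      nlinarith [abs_nonneg b]
    have hc : c ^ 2 ≤ 9 := by
      rw [← sq_abs]
      nlinarith [abs_nonneg c]
    nlinarith [sq_nonneg (a - b), sq_nonneg (b - c), sq_nonneg (a - c)]
  refine (expect_mono hlam hpt).trans ?_
  rw [expect_add, expect_add, expect_const_mul, expect_const_mul, expect_const hlam, expect_sum]
  have h1 := expect_sq_sum_fluct_le hG hlam v
  have h2 : ∑ u ∈ G.neighborFinset v, expect G lam (fun s => 1 - unocc u s) ≤ 3 := by
    refine (Finset.sum_le_card_nsmul _ _ lam fun u _ => expect_occupied_le hlam u).trans ?_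
    rw [nsmul_eq_mul]
    nlinarith
  nlinarith

/-- Mean-square distance, in square-root coordinates, between the random cavity fields and a
belief-propagation fixed point. -/
lemma expect_sq_sqrt_cavity_sub_sqrt_le (hG : 6 ≤ G.egirth) (hlam : 0 < lam) {D η : ℝ}
    (hD1 : 1 ≤ D) (hdeg : ∀ u, ((G.neighborFinset u).card : ℝ) ≤ D) (hD : lam * D ≤ 3)
    (hη : 0 < η) (hη1 : η ≤ 1 / 2) (hsub : lam * D * Real.exp (-1) ≤ 1 - 2 * η) {ω : V → ℝ}
    (hω : ∀ u, ω u ∈ Set.Icc (0 : ℝ) 1) (hfix : bpF G lam ω = ω) (v : V) :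
    expect G lam (fun s => (√(cavity G lam v (G.neighborFinset v) s) - √(ω v)) ^ 2)
      ≤ (1 + 1 / η) / η * (217 / D) := by
  set m : V → ℝ := fun u =>
    expect G lam (fun s => (√(cavity G lam u (G.neighborFinset u) s) - √(ω u)) ^ 2) with hm
  have hm0 : ∀ u, 0 ≤ m u := fun u =>
    Finset.sum_nonneg fun s _ => mul_nonneg (gibbs_nonneg hlam s) (sq_nonneg _)
  have hD0 : 0 < D := by linarith
  have hlamD : lam ≤ 3 / D := by rwa [le_div_iff₀ hD0]
  have herr : D ^ 2 * lam ^ 4 / 2 + lam ^ 2 / 2 * (12 * D + 27) ≤ 217 / D := by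
    have hsq : (lam * D) ^ 2 ≤ 9 := by nlinarith [mul_pos hlam hD0]
    rw [le_div_iff₀ hD0]
    have h1 : (D ^ 2 * lam ^ 4 / 2 + lam ^ 2 / 2 * (12 * D + 27)) * D * D
        ≤ 217 * D := by
      have h2 : (D ^ 2 * lam ^ 4 / 2 + lam ^ 2 / 2 * (12 * D + 27)) * D * D
          = ((lam * D) ^ 2) ^ 2 / 2 + (lam * D) ^ 2 * (12 * D + 27) / 2 := by ring
      rw [h2]
      nlinarith [sq_nonneg (lam * D)]
    exact le_of_mul_le_mul_right h1 hD0
  have hstep : ∀ u M, (∀ w, m w ≤ M) → 0 ≤ M →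
      m u ≤ (1 - η) * M + (1 + 1 / η) * (217 / D) := by
    intro u M hM hM0
    have hcard0 : (0 : ℝ) ≤ (G.neighborFinset u).card := Nat.cast_nonneg _
    have hcard := hdeg u
    have hpt : ∀ s, (√(cavity G lam u (G.neighborFinset u) s) - √(ω u)) ^ 2 ≤
        (1 + η) * (lam * Real.exp (-1)) * ∑ w ∈ G.neighborFinset u,
            (√(cavity G lam w (G.neighborFinset w) s) - √(ω w)) ^ 2
          + (1 + 1 / η) * (D ^ 2 * lam ^ 4 / 2 + lam ^ 2 / 2 * (∑ w ∈ G.neighborFinset u,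
            (vac G u w s - cavity G lam w (G.neighborFinset w) s)) ^ 2) := by
      intro s
      have h := sq_sqrt_prod_sub_sqrt_prod_le (G.neighborFinset u) hlam hη
        (z := fun w => vac G u w s) (x := fun w => cavity G lam w (G.neighborFinset w) s) (y := ω)
        (fun w => ⟨vac_nonneg G u w s, vac_le_one G u w s⟩)
        (fun w => (cavity_pos G w s hlam _).le) hω
      have hωu : ∏ w ∈ G.neighborFinset u, (1 + lam * ω w)⁻¹ = ω u := congrFun hfix u
      rw [hωu] at h
      refine h.trans ?_
      gcongr
    refine (expect_mono hlam hpt).trans ?_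
    rw [expect_add, expect_const_mul, expect_const_mul, expect_add, expect_const hlam,
      expect_const_mul, expect_sum]
    have h1 : ∑ w ∈ G.neighborFinset u, m w ≤ D * M := by
      refine (Finset.sum_le_card_nsmul _ _ M fun w _ => hM w).trans ?_
      rw [nsmul_eq_mul]
      exact mul_le_mul_of_nonneg_right hcard hM0
    have h2 := expect_sq_sum_vac_sub_cavity_le hG hlam hdeg hD u
    have h3 : (1 + η) * (lam * Real.exp (-1)) * ∑ w ∈ G.neighborFinset u, m w
        ≤ (1 - η) * M := by
      calc (1 + η) * (lam * Real.exp (-1)) * ∑ w ∈ G.neighborFinset u, m w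
          ≤ (1 + η) * (lam * Real.exp (-1)) * (D * M) := by gcongr
        _ = (1 + η) * (lam * D * Real.exp (-1)) * M := by ring
        _ ≤ (1 + η) * (1 - 2 * η) * M := by gcongr
        _ ≤ (1 - η) * M := mul_le_mul_of_nonneg_right (by nlinarith) hM0
    refine add_le_add h3 (mul_le_mul_of_nonneg_left ?_ (by positivity))
    refine le_trans ?_ herr
    gcongr
  obtain ⟨u, -, hu⟩ := Finset.exists_max_image Finset.univ m ⟨v, Finset.mem_univ v⟩
  have h := hstep u (m u) (fun w => hu w (Finset.mem_univ w)) (hm0 u)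
  refine (hu v (Finset.mem_univ v)).trans ?_
  rw [div_mul_eq_mul_div, le_div_iff₀ hη]
  linarith

end HardCore

namespace HardCore

lemma lambdaC_mul_le (n : ℕ) (hn : 1 ≤ n) :
    lambdaC (n + 2) * ((n + 2 : ℕ) : ℝ) ≤ Real.exp 1 * (1 + 5 / n) := by
  have hn0 : (1 : ℝ) ≤ n := by exact_mod_cast hn
  have hpow : ((n : ℝ) + 1) ^ n ≤ Real.exp 1 * (n : ℝ) ^ n := by
    have h1 : (1 / (n : ℝ) + 1) ^ n ≤ Real.exp 1 := by
      calc (1 / (n : ℝ) + 1) ^ n ≤ Real.exp (1 / n) ^ n := by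
            gcongr
            exact Real.add_one_le_exp _
        _ = Real.exp 1 := by rw [← Real.exp_nat_mul, mul_one_div_cancel (by positivity)]
    have h2 : ((n : ℝ) + 1) ^ n = (1 / (n : ℝ) + 1) ^ n * (n : ℝ) ^ n := by
      rw [← mul_pow]
      congr 1
      field_simp
      ring
    rw [h2]
    gcongr
  have hval : lambdaC (n + 2) * ((n + 2 : ℕ) : ℝ)
      = ((n : ℝ) + 1) ^ n * ((n + 1) * (n + 2)) / ((n : ℝ) ^ n * n ^ 2) := by
    unfold lambdaC
    rw [show n + 2 - 1 = n + 1 by omega, ← pow_add]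
    push_cast
    rw [show (n : ℝ) + 2 - 1 = n + 1 by ring, show (n : ℝ) + 2 - 2 = n by ring]
    ring
  have hrat : ((n : ℝ) + 1) * (n + 2) ≤ (1 + 5 / n) * n ^ 2 := by
    have h : (1 + 5 / (n : ℝ)) * n ^ 2 = n ^ 2 + 5 * n := by field_simp
    rw [h]
    nlinarith
  rw [hval, div_le_iff₀ (by positivity)]
  calc ((n : ℝ) + 1) ^ n * ((n + 1) * (n + 2))
      ≤ Real.exp 1 * (n : ℝ) ^ n * ((1 + 5 / n) * n ^ 2) := by gcongr
    _ = Real.exp 1 * (1 + 5 / n) * ((n : ℝ) ^ n * n ^ 2) := by ring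

variable {V : Type} {G : SimpleGraph V} [Fintype V] [DecidableEq V] {lam : ℝ}

lemma gibbsProb_mem_eq (v : V) :
    gibbsProb G lam {σ : Finset V | v ∈ σ} = expect G lam (fun s => 1 - unocc v s) := by
  unfold gibbsProb expect unocc
  refine Finset.sum_congr rfl fun s _ => ?_
  by_cases h : v ∈ s <;> simp [h]

variable [DecidableRel G.Adj]

lemma gibbsProb_mem_eq_cavity (hG : 6 ≤ G.egirth) (hlam : 0 < lam) (v : V) :
    gibbsProb G lam {σ : Finset V | v ∈ σ}
      = lam * expect G lam (fun s => unocc v s * cavity G lam v (G.neighborFinset v) s) := by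
  have h1 := expect_eq_expect_unocc (G := G) (lam := lam) v (f := fun _ => 1) fun _ => rfl
  have h2 := expect_unocc_mul_cavity (G := G) hlam (u := v) (B := G.neighborFinset v)
    (H := fun _ => 1) (by simp) (neighborFinset_indep hG v) fun _ _ _ => rfl
  have h3 : ∀ s, ∏ w ∈ G.neighborFinset v, unocc w s = vac G v v s := fun s => by
    rw [← prod_unocc_erase v v s, Finset.erase_eq_of_notMem (by simp)]
  simp only [h3, mul_one] at h1 h2
  rw [gibbsProb_mem_eq, h2, expect_sub, h1, ← expect_const_mul, ← expect_sub]
  congr 1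
  funext s
  ring

lemma exp_neg_three_le_cavity (hlam : 0 < lam) {D : ℝ} (v : V)
    (hdeg : ((G.neighborFinset v).card : ℝ) ≤ D) (hD : lam * D ≤ 3) (s : Finset V) :
    Real.exp (-3) ≤ cavity G lam v (G.neighborFinset v) s := by
  calc Real.exp (-3) ≤ Real.exp (-lam) ^ (G.neighborFinset v).card := by
        rw [← Real.exp_nat_mul]
        refine Real.exp_le_exp.2 ?_
        nlinarith
    _ = ∏ _w ∈ G.neighborFinset v, Real.exp (-lam) := (Finset.prod_const _).symm
    _ ≤ cavity G lam v (G.neighborFinset v) s := by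
        refine Finset.prod_le_prod (fun _ _ => (Real.exp_pos _).le) fun w _ => ?_
        rw [Real.exp_neg]
        refine inv_anti₀ (one_pos.trans_le (one_le_one_add_mul_vac G v w s hlam)) ?_
        have h := Real.add_one_le_exp lam
        nlinarith [vac_le_one G v w s]

/-- The relative error of belief propagation is controlled by the mean-square distance between the
random cavity field and the fixed point. -/
lemma abs_marginal_div_gibbsProb_sub_one_le (hG : 6 ≤ G.egirth) (hlam : 0 < lam)
    (hlam2 : lam ≤ 1 / 2) {D κ : ℝ} (v : V)
    (hdeg : ((G.neighborFinset v).card : ℝ) ≤ D) (hD : lam * D ≤ 3) {ω : V → ℝ}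
    (hω : ω v ∈ Set.Icc (0 : ℝ) 1)
    (hκ : expect G lam (fun s => (√(cavity G lam v (G.neighborFinset v) s) - √(ω v)) ^ 2) ≤ κ) :
    |(lam * ω v / (1 + lam * ω v)) / gibbsProb G lam {σ : Finset V | v ∈ σ} - 1|
      ≤ 2 * Real.exp 3 * (2 * lam + 2 * √κ) := by
  obtain ⟨hω0, hω1⟩ := hω
  set R := cavity G lam v (G.neighborFinset v) with hR
  set a := expect G lam (fun s => unocc v s * R s) with ha
  have hR0 : ∀ s, 0 < R s := fun s => cavity_pos G v s hlam _
  have hR1 : ∀ s, R s ≤ 1 := fun s => cavity_le_one G v s hlam _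
  have hocc := expect_occupied_le (G := G) hlam v
  have ha_low : Real.exp (-3) / 2 ≤ a := by
    have h1 : expect G lam (fun s => Real.exp (-3) * (1 - (1 - unocc v s))) ≤ a :=
      expect_mono hlam fun s => by
        have := mul_le_mul_of_nonneg_left
          (exp_neg_three_le_cavity (G := G) hlam v hdeg hD s) (unocc_nonneg v s)
        linarith
    rw [expect_const_mul, expect_sub, expect_const hlam] at h1
    nlinarith [Real.exp_pos (-3)]
  have hfield : expect G lam (fun s => |R s - ω v|) ≤ 2 * √κ := by
    have h1 : expect G lam (fun s => |R s - ω v|)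
        ≤ expect G lam (fun s => 2 * |√(R s) - √(ω v)|) := expect_mono hlam fun s => by
      have h2 : R s - ω v = (√(R s) + √(ω v)) * (√(R s) - √(ω v)) := by
        rw [← sq_sub_sq, Real.sq_sqrt (hR0 s).le, Real.sq_sqrt hω0]
      have h3 : √(R s) ≤ 1 := Real.sqrt_le_one.2 (hR1 s)
      have h4 : √(ω v) ≤ 1 := Real.sqrt_le_one.2 hω1
      rw [h2, abs_mul, abs_of_nonneg (by positivity)]
      gcongr
      linarith
    rw [expect_const_mul] at h1
    refine h1.trans (mul_le_mul_of_nonneg_left (Real.le_sqrt_of_sq_le ?_) (by norm_num))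
    refine (sq_expect_le hlam _).trans ?_
    simpa only [sq_abs] using hκ
  have ha_close : |a - ω v| ≤ lam + 2 * √κ := by
    have hup : a - ω v ≤ expect G lam (fun s => |R s - ω v|) := by
      have h2 : a ≤ expect G lam (fun s => |R s - ω v| + ω v) := expect_mono hlam fun s => by
        have := le_abs_self (R s - ω v)
        have := mul_le_of_le_one_left (hR0 s).le (unocc_le_one v s)
        linarith
      rw [expect_add, expect_const hlam] at h2
      linarith
    have hlow : ω v - expect G lam (fun s => |R s - ω v|) - lam ≤ a := by
      have h2 : expect G lam (fun s => ω v - |R s - ω v| - (1 - unocc v s)) ≤ a :=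
        expect_mono hlam fun s => by
          have h3 := neg_abs_le (R s - ω v)
          have h4 : (1 - unocc v s) * R s ≤ 1 - unocc v s :=
            mul_le_of_le_one_right (sub_nonneg.2 (unocc_le_one v s)) (hR1 s)
          linarith
      rw [expect_sub, expect_sub, expect_const hlam] at h2
      linarith
    rw [abs_le]
    constructor <;> linarith
  have hden : 0 < 1 + lam * ω v := by positivity
  have hmarg : |ω v / (1 + lam * ω v) - ω v| ≤ lam := by
    have h1 : ω v / (1 + lam * ω v) - ω v = -(lam * ω v ^ 2 / (1 + lam * ω v)) := by
      field_simp
      ring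
    rw [h1, abs_neg, abs_of_nonneg (by positivity), div_le_iff₀ hden]
    nlinarith [mul_nonneg hlam.le hω0, mul_nonneg hlam.le (sub_nonneg.2 hω1)]
  have ha0 : 0 < a := lt_of_lt_of_le (by positivity) ha_low
  have hratio : (lam * ω v / (1 + lam * ω v)) / gibbsProb G lam {σ : Finset V | v ∈ σ} - 1
      = ((ω v / (1 + lam * ω v) - ω v) - (a - ω v)) / a := by
    rw [gibbsProb_mem_eq_cavity hG hlam]
    change (lam * ω v / (1 + lam * ω v)) / (lam * a) - 1 = _
    field_simp
    ring
  rw [hratio, abs_div, abs_of_pos ha0, div_le_iff₀ ha0]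
  calc |(ω v / (1 + lam * ω v) - ω v) - (a - ω v)|
      ≤ 2 * lam + 2 * √κ := (abs_sub _ _).trans (by linarith)
    _ = 2 * Real.exp 3 * (2 * lam + 2 * √κ) * (Real.exp (-3) / 2) := by
        rw [Real.exp_neg]
        field_simp
    _ ≤ 2 * Real.exp 3 * (2 * lam + 2 * √κ) * a := by gcongr

lemma exists_error_le (K : ℝ) {ε : ℝ} (hε : 0 < ε) : ∃ N : ℕ, ∀ D : ℕ, N ≤ D →
    2 * Real.exp 3 * (2 * (3 / (D : ℝ)) + 2 * √(K / D)) ≤ ε := by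
  have h1 := tendsto_const_div_atTop_nhds_zero_nat (3 : ℝ)
  have h2 := (tendsto_const_div_atTop_nhds_zero_nat K).sqrt
  have h3 := ((h1.const_mul 2).add (h2.const_mul 2)).const_mul (2 * Real.exp 3)
  simp only [Real.sqrt_zero, mul_zero, add_zero] at h3
  exact Filter.eventually_atTop.1 (h3.eventually_le_const hε)

end HardCore

theorem bp_fixed_point_approximates_occupation_probability :
    ∀ δ ε : ℝ, 0 < δ → 0 < ε →
    ∃ Δ₀ : ℕ,
      ∀ (V : Type) [Fintype V] [DecidableEq V] (G : SimpleGraph V) [DecidableRel G.Adj]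
        (Δ : ℕ) (lam : ℝ),
        G.maxDegree = Δ → Δ₀ ≤ Δ → 6 ≤ G.egirth →
        0 < lam → lam < (1 - δ) * lambdaC Δ →
        ∀ ωstar : V → ℝ, (∀ u : V, ωstar u ∈ Set.Icc (0 : ℝ) 1) →
          bpF G lam ωstar = ωstar →
        ∀ v : V,
          |(lam * ωstar v / (1 + lam * ωstar v)) /
              gibbsProb G lam {σ : Finset V | v ∈ σ} - 1| ≤ ε := by
  intro δ ε hδ hε
  obtain ⟨N₁, hN₁⟩ := exists_error_le ((1 + 1 / (δ / 4)) / (δ / 4) * 217) hε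
  obtain ⟨N₂, hN₂⟩ := exists_nat_ge (10 / δ)
  refine ⟨max N₁ (N₂ + 6), ?_⟩
  intro V _ _ G _ Δ lam hmax hΔ hG hlam hlt ω hω hfix v
  obtain ⟨n, rfl⟩ : ∃ n, Δ = n + 2 := ⟨Δ - 2, by omega⟩
  have hn4 : (4 : ℝ) ≤ n := by exact_mod_cast (by omega : 4 ≤ n)
  have hn : 10 / δ ≤ n := hN₂.trans (by exact_mod_cast (by omega : N₂ ≤ n))
  have hcast : (((n + 2 : ℕ) : ℝ)) = n + 2 := by push_cast; ring
  have hpos : 0 < lambdaC (n + 2) := by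
    unfold lambdaC
    rw [hcast]
    have h1 : (0 : ℝ) < n + 2 - 1 := by linarith
    have h2 : (0 : ℝ) < n + 2 - 2 := by linarith
    positivity
  have hδ1 : 0 < 1 - δ := pos_of_mul_pos_left (hlam.trans hlt) hpos.le
  have hsub : lam * ((n + 2 : ℕ) : ℝ) * Real.exp (-1) ≤ 1 - 2 * (δ / 4) := by
    have h1 : 5 / (n : ℝ) ≤ δ / 2 := by
      rw [div_le_iff₀ hδ] at hn
      rw [div_le_iff₀ (by linarith)]
      linarith
    calc lam * ((n + 2 : ℕ) : ℝ) * Real.exp (-1)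
        ≤ (1 - δ) * lambdaC (n + 2) * ((n + 2 : ℕ) : ℝ) * Real.exp (-1) := by gcongr
      _ = (1 - δ) * (lambdaC (n + 2) * ((n + 2 : ℕ) : ℝ)) * Real.exp (-1) := by ring
      _ ≤ (1 - δ) * (Real.exp 1 * (1 + 5 / n)) * Real.exp (-1) := by
          have := lambdaC_mul_le n (by omega)
          gcongr
      _ = (1 - δ) * (1 + 5 / n) := by
          rw [Real.exp_neg]
          field_simp
      _ ≤ (1 - δ) * (1 + δ / 2) := by gcongr
      _ ≤ 1 - 2 * (δ / 4) := by nlinarith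
  have hD : lam * ((n + 2 : ℕ) : ℝ) ≤ 3 := by
    have h1 : lam * ((n + 2 : ℕ) : ℝ) * Real.exp (-1) ≤ 1 := by linarith
    rw [Real.exp_neg, ← div_eq_mul_inv, div_le_one (Real.exp_pos 1)] at h1
    linarith [Real.exp_one_lt_d9]
  have hlamD : lam ≤ 3 / ((n + 2 : ℕ) : ℝ) := by
    rw [le_div_iff₀ (by positivity)]
    exact hD
  have hdeg : ∀ u, ((G.neighborFinset u).card : ℝ) ≤ ((n + 2 : ℕ) : ℝ) := fun u => by
    rw [← hmax]
    exact_mod_cast G.degree_le_maxDegree u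
  have hκ := expect_sq_sqrt_cavity_sub_sqrt_le hG hlam (by rw [hcast]; linarith) hdeg hD
    (by linarith : 0 < δ / 4) (by linarith) hsub hω hfix v
  rw [← mul_div_assoc] at hκ
  refine (abs_marginal_div_gibbsProb_sub_one_le hG hlam (by rw [hcast] at hD; nlinarith) v
    (hdeg v) hD (hω v) hκ).trans ((?_ : _ ≤ _).trans (hN₁ (n + 2) (by omega)))
  gcongr
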